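/- arXiv:2511.20575 — 6 statements merged into one kernel-verified Lean document; each statement's English description precedes it below -/
import Mathlib

section
/- Let X and Y be independent real-valued random variables on a probability space, where X has probability density f with respect to Lebesgue measure and Y has cumulative distribution function F (i.e., F(t) = P(Y ≤ t)). Then for every Borel set A ⊆ ℝ, P(X ∈ A and Y ≤ X) = ∫_A f(x) F(x) dx. Consequently, if P(Y ≤ X) > 0, the conditional distribution of X given the event {Y ≤ X} has density c · f(x) F(x), where c = 1 / ∫_ℝ f(x) F(x) dx. -/
open MeasureTheory

/-- Vaduva's acceptance step: if `X` has density `f` and `Y` has CDF `F`, with `X, Y`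
independent, then `P(X ∈ A, Y ≤ X) = ∫_A f x * F x dx`, and consequently the conditional
distribution of `X` given `{Y ≤ X}` has density `c · f · F` with
`c = 1 / ∫ f x * F x dx`. -/
theorem stmt0 {Ω : Type*} [MeasurableSpace Ω] (P : Measure Ω) [IsProbabilityMeasure P]
    (X Y : Ω → ℝ) (hX : Measurable X) (hY : Measurable Y)
    (hindep : ProbabilityTheory.IndepFun X Y P)
    (f : ℝ → ℝ) (hf : Measurable f) (hf0 : ∀ x, 0 ≤ f x)
    (hdens : Measure.map X P = volume.withDensity (fun x => ENNReal.ofReal (f x)))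
    (F : ℝ → ℝ) (hF : ∀ t, F t = (P {ω | Y ω ≤ t}).toReal) :
    (∀ A : Set ℝ, MeasurableSet A →
      (P {ω | X ω ∈ A ∧ Y ω ≤ X ω}).toReal = ∫ x in A, f x * F x) ∧
    (0 < P {ω | Y ω ≤ X ω} →
      ∀ A : Set ℝ, MeasurableSet A →
        (P {ω | X ω ∈ A ∧ Y ω ≤ X ω}).toReal / (P {ω | Y ω ≤ X ω}).toReal
          = ∫ x in A, (1 / ∫ x, f x * F x) * (f x * F x)) := by
  have hFmono : Monotone F := by
    intro a b hab
    rw [hF, hF]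
    exact ENNReal.toReal_mono (measure_ne_top _ _)
      (measure_mono (fun ω (h : Y ω ≤ a) => le_trans h hab))
  have hFm : Measurable F := hFmono.measurable
  have hF0 : ∀ x, 0 ≤ F x := fun x => by rw [hF]; exact ENNReal.toReal_nonneg
  have hFY : ∀ x, ENNReal.ofReal (F x) = Measure.map Y P (Set.Iic x) := by
    intro x
    rw [hF, ENNReal.ofReal_toReal (measure_ne_top _ _), Measure.map_apply hY measurableSet_Iic]
    rfl
  have : IsProbabilityMeasure (Measure.map X P) := Measure.isProbabilityMeasure_map hX.aemeasurable
  have : IsProbabilityMeasure (Measure.map Y P) := Measure.isProbabilityMeasure_map hY.aemeasurable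
  have key : ∀ A : Set ℝ, MeasurableSet A →
      (P {ω | X ω ∈ A ∧ Y ω ≤ X ω}).toReal = ∫ x in A, f x * F x := by
    intro A hA
    have hS : MeasurableSet {p : ℝ × ℝ | p.1 ∈ A ∧ p.2 ≤ p.1} :=
      (measurable_fst hA).inter (measurableSet_le measurable_snd measurable_fst)
    have h1 : P {ω | X ω ∈ A ∧ Y ω ≤ X ω} =
        ((Measure.map X P).prod (Measure.map Y P)) {p : ℝ × ℝ | p.1 ∈ A ∧ p.2 ≤ p.1} := by
      rw [← (ProbabilityTheory.indepFun_iff_map_prod_eq_prod_map_map hX.aemeasurable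
        hY.aemeasurable).1 hindep, Measure.map_apply (hX.prodMk hY) hS]
      rfl
    have h2 : ∀ x, Measure.map Y P (Prod.mk x ⁻¹' {p : ℝ × ℝ | p.1 ∈ A ∧ p.2 ≤ p.1}) =
        A.indicator (fun x => ENNReal.ofReal (F x)) x := by
      intro x
      by_cases hx : x ∈ A
      · rw [Set.indicator_of_mem hx, hFY]
        congr 1
        ext y
        simp [hx]
      · rw [Set.indicator_of_notMem hx]
        have : Prod.mk x ⁻¹' {p : ℝ × ℝ | p.1 ∈ A ∧ p.2 ≤ p.1} = ∅ := by
          ext y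
          simp [hx]
        rw [this, measure_empty]
    have h3 : P {ω | X ω ∈ A ∧ Y ω ≤ X ω} = ∫⁻ x in A, ENNReal.ofReal (f x * F x) := by
      rw [h1, Measure.prod_apply hS, lintegral_congr h2, lintegral_indicator hA, hdens,
        restrict_withDensity hA, lintegral_withDensity_eq_lintegral_mul _ hf.ennreal_ofReal
          hFm.ennreal_ofReal]
      refine lintegral_congr fun x => ?_
      rw [ENNReal.ofReal_mul (hf0 x)]
      rfl
    rw [h3, integral_eq_lintegral_of_nonneg_ae
      (Filter.Eventually.of_forall fun x => mul_nonneg (hf0 x) (hF0 x))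
      (hf.mul hFm).aestronglyMeasurable]
  refine ⟨key, fun _ A hA => ?_⟩
  have hu := key Set.univ MeasurableSet.univ
  simp only [Set.mem_univ, true_and, Measure.restrict_univ] at hu
  rw [key A hA, hu, integral_const_mul]
  ring
end

section
/- Let K ⊂ ℝⁿ be a compact set and f : K → ℝ continuous with a unique minimizer x* ∈ K, and suppose that for every open neighborhood U of x* the Lebesgue measure of K ∩ U is positive. Then the Gibbs mean converges to the minimizer: lim_{κ → ∞} (∫_K x exp(−κ f(x)) dx) / (∫_K exp(−κ f(x)) dx) = x* (convergence in ℝⁿ, the integrals being with respect to Lebesgue measure). -/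
open Filter MeasureTheory

/-- Pincus: on a compact set `K ⊆ ℝⁿ`, if the continuous function `f` has a unique
minimizer `x*` and every neighbourhood of `x*` meets `K` in a set of positive
Lebesgue measure, then the mean of the Boltzmann distribution
`π_κ ∝ exp(−κ f)` on `K` converges to `x*` as `κ → ∞`. -/
theorem stmt2 {n : ℕ} (K : Set (EuclideanSpace ℝ (Fin n))) (hK : IsCompact K)
    (f : EuclideanSpace ℝ (Fin n) → ℝ) (hf : ContinuousOn f K)
    (xstar : EuclideanSpace ℝ (Fin n)) (hxK : xstar ∈ K)
    (hmin : ∀ y ∈ K, y ≠ xstar → f xstar < f y)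
    (hmeas : ∀ U : Set (EuclideanSpace ℝ (Fin n)), IsOpen U → xstar ∈ U →
      0 < volume (K ∩ U)) :
    Tendsto
      (fun κ : ℝ =>
        (∫ x in K, Real.exp (-κ * f x))⁻¹ • ∫ x in K, Real.exp (-κ * f x) • x)
      atTop (nhds xstar) := by
  have I : ∀ κ : ℝ, IntegrableOn (fun x => Real.exp (-κ * f x)) K volume := fun κ =>
    ContinuousOn.integrableOn_compact hK
      (Real.continuous_exp.comp_continuousOn (continuousOn_const.mul hf))
  have J : ∀ κ : ℝ, 0 ≤ᵐ[volume.restrict K] fun x => Real.exp (-κ * f x) := fun κ =>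
    Eventually.of_forall fun x => (Real.exp_pos _).le
  have P : ∀ κ : ℝ, (0 : ℝ) < ∫ x in K, Real.exp (-κ * f x) := by
    intro κ
    refine (setIntegral_pos_iff_support_of_nonneg_ae (J κ) (I κ)).2 ?_
    apply (hmeas Set.univ isOpen_univ (Set.mem_univ _)).trans_le
    exact measure_mono fun x hx => ⟨(Real.exp_pos _).ne', hx.1⟩
  let φ : ℝ → EuclideanSpace ℝ (Fin n) → ℝ :=
    fun κ x => (∫ x in K, Real.exp (-κ * f x))⁻¹ * Real.exp (-κ * f x)
  have hnφ : ∀ κ, ∀ x ∈ K, 0 ≤ φ κ x := fun κ x _ =>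
    mul_nonneg (inv_nonneg.2 (P κ).le) (Real.exp_pos _).le
  have hiφ : ∀ κ, ∫ x in K, φ κ x = 1 := fun κ => by
    rw [integral_const_mul, inv_mul_cancel₀ (P κ).ne']
  have A : ∀ u : Set (EuclideanSpace ℝ (Fin n)), IsOpen u → xstar ∈ u →
      TendstoUniformlyOn φ 0 atTop (K \ u) := by
    intro u u_open hu
    obtain ⟨t, htx, ht⟩ : ∃ t, f xstar < t ∧ ∀ x ∈ K \ u, t ≤ f x := by
      rcases Set.eq_empty_or_nonempty (K \ u) with (h | h)
      · exact ⟨f xstar + 1, by linarith, by simp [h]⟩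
      obtain ⟨x, hx, h'x⟩ : ∃ x ∈ K \ u, ∀ y ∈ K \ u, f x ≤ f y :=
        IsCompact.exists_isMinOn (hK.diff u_open) h (hf.mono Set.sdiff_subset)
      refine ⟨f x, hmin x hx.1 ?_, h'x⟩
      rintro rfl
      exact hx.2 hu
    obtain ⟨t', t'x, tt'⟩ : ∃ t', f xstar < t' ∧ t' < t := exists_between htx
    obtain ⟨v, v_open, x_v, hv⟩ : ∃ v : Set (EuclideanSpace ℝ (Fin n)),
        IsOpen v ∧ xstar ∈ v ∧ v ∩ K ⊆ f ⁻¹' Set.Iio t' :=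
      _root_.continuousOn_iff.1 hf xstar hxK (Set.Iio t') isOpen_Iio t'x
    have hlt : volume (v ∩ K) < ⊤ :=
      (measure_mono Set.inter_subset_right).trans_lt hK.measure_lt_top
    have hm : 0 < volume.real (v ∩ K) := by
      refine ENNReal.toReal_pos ?_ hlt.ne
      rw [Set.inter_comm]
      exact (hmeas v v_open x_v).ne'
    have M : ∀ κ : ℝ, 0 ≤ κ → ∀ x ∈ K \ u,
        φ κ x ≤ (volume.real (v ∩ K))⁻¹ * Real.exp (-(κ * (t - t'))) := by
      intro κ hκ x hx
      have B : Real.exp (-κ * t') * volume.real (v ∩ K) ≤ ∫ y in K, Real.exp (-κ * f y) :=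
        calc
          Real.exp (-κ * t') * volume.real (v ∩ K) = ∫ _ in v ∩ K, Real.exp (-κ * t') := by
            simp [mul_comm]
          _ ≤ ∫ y in v ∩ K, Real.exp (-κ * f y) := by
            apply setIntegral_mono_on _ _ (v_open.measurableSet.inter hK.measurableSet) _
            · exact integrableOn_const hlt.ne
            · exact (I κ).mono Set.inter_subset_right le_rfl
            · intro y hy
              have h1 : f y < t' := hv hy
              apply Real.exp_le_exp.2
              nlinarith
          _ ≤ ∫ y in K, Real.exp (-κ * f y) :=
            setIntegral_mono_set (I κ) (J κ) (Eventually.of_forall Set.inter_subset_right)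
      have C : Real.exp (-κ * f x) ≤ Real.exp (-κ * t) := by
        apply Real.exp_le_exp.2
        nlinarith [ht x hx]
      have hpos : 0 < Real.exp (-κ * t') * volume.real (v ∩ K) := by positivity
      calc φ κ x ≤ (Real.exp (-κ * t') * volume.real (v ∩ K))⁻¹ * Real.exp (-κ * t) := by
            apply mul_le_mul (inv_anti₀ hpos B) C (Real.exp_pos _).le (inv_nonneg.2 hpos.le)
        _ = (volume.real (v ∩ K))⁻¹ * Real.exp (-(κ * (t - t'))) := by
            have : -(κ * (t - t')) = -(-κ * t') + -κ * t := by ring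
            rw [this, Real.exp_add, Real.exp_neg, mul_inv]
            ring
    have N : Tendsto (fun κ : ℝ => (volume.real (v ∩ K))⁻¹ * Real.exp (-(κ * (t - t')))) atTop
        (nhds ((volume.real (v ∩ K))⁻¹ * 0)) := by
      apply Tendsto.mul tendsto_const_nhds
      exact Real.tendsto_exp_neg_atTop_nhds_zero.comp
        (tendsto_id.atTop_mul_const (sub_pos.2 tt'))
    rw [mul_zero] at N
    refine Metric.tendstoUniformlyOn_iff.2 fun ε εpos => ?_
    filter_upwards [(tendsto_order.1 N).2 ε εpos, eventually_ge_atTop 0] with κ hκ h0 x hx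
    simp only [Pi.zero_apply, dist_zero_left, Real.norm_of_nonneg (hnφ κ x hx.1)]
    exact (M κ h0 x hx).trans_lt hκ
  have main : Tendsto (fun κ : ℝ => ∫ x in K, φ κ x • x) atTop (nhds xstar) := by
    have B : Tendsto (fun κ ↦ ∫ x in K, φ κ x) atTop (nhds 1) :=
      tendsto_const_nhds.congr (fun κ ↦ (hiφ κ).symm)
    have C : ∀ᶠ κ in atTop, AEStronglyMeasurable (φ κ) (volume.restrict K) :=
      Eventually.of_forall (fun κ ↦ ((I κ).const_mul _).aestronglyMeasurable)
    exact tendsto_setIntegral_peak_smul_of_integrableOn_of_tendsto (g := fun x => x)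
      hK.measurableSet hK.measurableSet Set.Subset.rfl self_mem_nhdsWithin
      hK.measure_lt_top.ne (Eventually.of_forall hnφ) A B C
      (continuousOn_id.integrableOn_compact hK) continuousWithinAt_id
  refine main.congr fun κ => ?_
  simp_rw [φ, ← smul_smul, integral_smul]
end

section
/- Let K ⊂ ℝⁿ be a compact set and G : K → ℝ continuous with G(x) > 0 for all x ∈ K, having a unique maximizer x* ∈ K, and suppose that for every open neighborhood U of x* the Lebesgue measure of K ∩ U is positive. Then lim_{J → ∞} (∫_K x G(x)^J dx) / (∫_K G(x)^J dx) = x*; i.e., the probability distributions with density proportional to G(x)^J collapse onto the maximizer x* as J → ∞. -/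
open Filter MeasureTheory

/-- On a compact `K ⊆ ℝⁿ`, if the continuous positive function `G` has a unique
maximizer `x*` and every neighbourhood of `x*` meets `K` in a set of positive
Lebesgue measure, then the distributions with density proportional to `G(x)^J`
collapse onto the maximizer: the mean converges to `x*` as `J → ∞`. -/
theorem stmt3 {n : ℕ} (K : Set (EuclideanSpace ℝ (Fin n))) (hK : IsCompact K)
    (G : EuclideanSpace ℝ (Fin n) → ℝ) (hG : ContinuousOn G K)
    (hGpos : ∀ x ∈ K, 0 < G x)
    (xstar : EuclideanSpace ℝ (Fin n)) (hxK : xstar ∈ K)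
    (hmax : ∀ y ∈ K, y ≠ xstar → G y < G xstar)
    (hmeas : ∀ U : Set (EuclideanSpace ℝ (Fin n)), IsOpen U → xstar ∈ U →
      0 < volume (K ∩ U)) :
    Tendsto
      (fun J : ℕ =>
        (∫ x in K, G x ^ J)⁻¹ • ∫ x in K, (G x ^ J) • x)
      atTop (nhds xstar) := by
  exact tendsto_setIntegral_pow_smul_of_unique_maximum_of_isCompact_of_measure_nhdsWithin_pos
    (g := fun x => x) hK
    (fun u hu hx => by rw [Set.inter_comm]; exact hmeas u hu hx) hG hmax
    (fun x hx => (hGpos x hx).le) (hGpos _ hxK) hxK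
    (continuousOn_id.integrableOn_compact hK) continuousWithinAt_id
end

section
/- Let k ≥ 2 and let λ₁, …, λ_{k−1} be pairwise distinct positive real numbers. Let Δ = {x ∈ ℝ^{k−1} : x_j ≥ 0 for all j, Σ_{j=1}^{k−1} x_j ≤ 1} be the unit simplex. Then ∫_Δ exp(−Σ_{j=1}^{k−1} λ_j x_j) dx = (∏_{j=1}^{k−1} λ_j)^{−1} · Σ_{j=1}^{k−1} (1 − e^{−λ_j}) · ∏_{i=1, i≠j}^{k−1} λ_i/(λ_i − λ_j), where the integral is with respect to Lebesgue measure on ℝ^{k−1}. -/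
open MeasureTheory

/-- The simplex of size `t`. -/
def simplexS (n : ℕ) (t : ℝ) : Set (Fin n → ℝ) := {x | (∀ j, 0 ≤ x j) ∧ ∑ j, x j ≤ t}

lemma simplexS_closed (n : ℕ) (t : ℝ) : IsClosed (simplexS n t) := by
  have : simplexS n t = (⋂ j, {x : Fin n → ℝ | 0 ≤ x j}) ∩ {x | ∑ j, x j ≤ t} := by
    ext x; simp [simplexS]
  rw [this]
  refine IsClosed.inter (isClosed_iInter fun j => isClosed_le (by fun_prop) (by fun_prop))
    (isClosed_le (by fun_prop) (by fun_prop))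

lemma simplexS_compact (n : ℕ) (t : ℝ) : IsCompact (simplexS n t) := by
  refine IsCompact.of_isClosed_subset (isCompact_Icc (a := fun _ : Fin n => (0:ℝ))
    (b := fun _ => t)) (simplexS_closed n t) ?_
  rintro x ⟨h0, h1⟩
  refine ⟨fun j => h0 j, fun j => ?_⟩
  exact (Finset.single_le_sum (fun i _ => h0 i) (Finset.mem_univ j)).trans h1

lemma cons_mem_simplexS (n : ℕ) (t s : ℝ) (y : Fin n → ℝ) :
    (Fin.cons s y : Fin (n+1) → ℝ) ∈ simplexS (n+1) t ↔ 0 ≤ s ∧ y ∈ simplexS n (t - s) := by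
  simp only [simplexS, Set.mem_setOf_eq, Fin.forall_fin_succ, Fin.sum_univ_succ, Fin.cons_zero,
    Fin.cons_succ, le_sub_iff_add_le', and_assoc]

/-- Fubini step. -/
lemma simplex_fubini (n : ℕ) (lam : Fin (n+1) → ℝ) (t : ℝ) (ht : 0 ≤ t) :
    ∫ x in simplexS (n+1) t, Real.exp (-∑ j, lam j * x j) =
      ∫ s in (0:ℝ)..t, Real.exp (-(lam 0 * s)) *
        ∫ y in simplexS n (t - s), Real.exp (-∑ j, lam j.succ * y j) := by
  have hint : Integrable ((simplexS (n+1) t).indicator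
      (fun x : Fin (n+1) → ℝ => Real.exp (-∑ j, lam j * x j))) volume := by
    rw [integrable_indicator_iff (simplexS_closed _ _).measurableSet]
    exact ContinuousOn.integrableOn_compact (simplexS_compact _ _) (by fun_prop)
  have hmp := (volume_preserving_piFinSuccAbove (fun _ : Fin (n+1) => ℝ) 0).symm
  rw [← integral_indicator (simplexS_closed _ _).measurableSet,
    ← hmp.integral_comp']
  rw [Measure.volume_eq_prod]
  refine (integral_prod _
    ((hmp.integrable_comp_emb (MeasurableEquiv.measurableEmbedding _)).2 hint)).trans ?_
  rw [intervalIntegral.integral_of_le ht, ← integral_Icc_eq_integral_Ioc,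
    ← integral_indicator measurableSet_Icc]
  congr 1
  ext s
  have hcons : ∀ y : Fin n → ℝ, (Fin.insertNthEquiv (fun _ : Fin (n+1) => ℝ) 0) (s, y) =
      (Fin.cons s y : Fin (n+1) → ℝ) := fun y => Fin.insertNth_zero' s y
  simp only [Function.comp_apply, MeasurableEquiv.piFinSuccAbove_symm_apply, hcons]
  by_cases hs : s ∈ Set.Icc 0 t
  · rw [Set.indicator_of_mem hs, ← integral_indicator (simplexS_closed _ _).measurableSet,
      ← integral_const_mul]
    congr 1
    ext y
    by_cases hy : y ∈ simplexS n (t - s)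
    · rw [Set.indicator_of_mem hy, Set.indicator_of_mem
        ((cons_mem_simplexS n t s y).2 ⟨hs.1, hy⟩), ← Real.exp_add]
      simp [Fin.sum_univ_succ]
      ring
    · rw [Set.indicator_of_notMem hy, Set.indicator_of_notMem
        (fun h => hy ((cons_mem_simplexS n t s y).1 h).2), mul_zero]
  · rw [Set.indicator_of_notMem hs]
    rw [← integral_zero (Fin n → ℝ) ℝ]
    congr 1
    ext y
    apply Set.indicator_of_notMem
    intro h
    obtain ⟨h1, h2, h3⟩ := (cons_mem_simplexS n t s y).1 h
    have := Finset.sum_nonneg (fun i (_ : i ∈ Finset.univ) => h2 i)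
    exact hs ⟨h1, by linarith⟩

/-- The Lagrange coefficient at `j`. -/
noncomputable def lagG {n : ℕ} (lam : Fin n → ℝ) (j : Fin n) : ℝ :=
  ∏ i ∈ Finset.univ.erase j, lam i / (lam i - lam j)

lemma sum_lagG {n : ℕ} (lam : Fin (n+1) → ℝ) (hd : Function.Injective lam) :
    ∑ j, lagG lam j = 1 := by
  have h := congrArg (Polynomial.eval 0)
    (Lagrange.sum_basis (s := Finset.univ) (v := lam) hd.injOn Finset.univ_nonempty)
  rw [Polynomial.eval_finset_sum, Polynomial.eval_one] at h
  rw [← h]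
  refine Finset.sum_congr rfl fun j _ => ?_
  rw [Lagrange.basis, Polynomial.eval_prod, lagG]
  refine Finset.prod_congr rfl fun i hi => ?_
  have hne : lam i - lam j ≠ 0 := sub_ne_zero.2 (fun h => (Finset.ne_of_mem_erase hi) (hd h))
  have hne' : lam j - lam i ≠ 0 := sub_ne_zero.2 (fun h => (Finset.ne_of_mem_erase hi) (hd h.symm))
  simp only [Lagrange.basisDivisor, Polynomial.eval_mul, Polynomial.eval_C, Polynomial.eval_sub,
    Polynomial.eval_X]
  field_simp
  ring

lemma lagG_succ {n : ℕ} (lam : Fin (n+1) → ℝ) (j : Fin n) :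
    lagG lam j.succ = lam 0 / (lam 0 - lam j.succ) * lagG (fun i => lam i.succ) j := by
  have : (Finset.univ.erase j.succ : Finset (Fin (n+1))) =
      insert 0 ((Finset.univ.erase j).map (Fin.succEmb n)) := by
    ext i
    refine Fin.cases ?_ (fun i => ?_) i
    · simp [(Fin.succ_ne_zero j).symm]
    · simp [Fin.succ_ne_zero]
  rw [lagG, this, Finset.prod_insert (by simp [Fin.succ_ne_zero]), Finset.prod_map]
  rfl

lemma integral_exp_neg (a t : ℝ) (ha : a ≠ 0) :
    ∫ s in (0:ℝ)..t, Real.exp (-(a * s)) = (1 - Real.exp (-(a * t))) / a := by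
  have h : ∀ s ∈ Set.uIcc 0 t, HasDerivAt (fun s => -Real.exp (-(a * s)) / a)
      (Real.exp (-(a * s))) s := by
    intro s _
    have h1 : HasDerivAt (fun s : ℝ => -(a * s)) (-(a * 1)) s :=
      ((hasDerivAt_id s).const_mul a).neg
    have h2 := (h1.exp.neg).div_const a
    have h3 : -(Real.exp (-(a * s)) * -(a * 1)) / a = Real.exp (-(a * s)) := by
      field_simp
    rw [h3] at h2
    exact h2
  rw [intervalIntegral.integral_eq_sub_of_hasDerivAt h
    (Continuous.intervalIntegrable (by fun_prop) _ _)]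
  simp
  ring

lemma simplex_formula (n : ℕ) : ∀ (lam : Fin n → ℝ) (_ : ∀ j, 0 < lam j)
    (_ : Function.Injective lam) (t : ℝ) (_ : 0 ≤ t),
    ∫ x in simplexS n t, Real.exp (-∑ j, lam j * x j) =
      (∏ j, lam j)⁻¹ * (1 - ∑ j, Real.exp (-(lam j * t)) * lagG lam j) := by
  induction n with
  | zero =>
    intro lam _ _ t ht
    have : simplexS 0 t = Set.univ := by ext x; simp [simplexS, ht]
    simp [this, measureReal_def, volume_pi, Measure.pi_of_empty]
  | succ n ih =>
    intro lam hpos hd t ht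
    have hd' : Function.Injective (fun i : Fin n => lam i.succ) :=
      hd.comp (Fin.succ_injective n)
    rw [simplex_fubini n lam t ht]
    have hne : ∀ j : Fin n, lam 0 - lam j.succ ≠ 0 := fun j =>
      sub_ne_zero.2 (fun h => (Fin.succ_ne_zero j).symm (hd h))
    have h0 : lam 0 ≠ 0 := (hpos 0).ne'
    have key : ∀ s ∈ Set.uIcc 0 t, Real.exp (-(lam 0 * s)) *
        ∫ y in simplexS n (t - s), Real.exp (-∑ j, lam j.succ * y j) =
        (∏ j : Fin n, lam j.succ)⁻¹ * (Real.exp (-(lam 0 * s)) -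
          ∑ j : Fin n, (Real.exp (-(lam j.succ * t)) * lagG (fun i => lam i.succ) j) *
            Real.exp (-((lam 0 - lam j.succ) * s))) := by
      intro s hs
      rw [Set.uIcc_of_le ht] at hs
      rw [ih (fun i => lam i.succ) (fun j => hpos _) hd' (t - s) (by linarith [hs.2])]
      rw [mul_left_comm, mul_sub, mul_one, Finset.mul_sum]
      congr 2
      refine Finset.sum_congr rfl fun j _ => ?_
      rw [← mul_assoc, mul_right_comm (Real.exp (-(lam j.succ * t))), ← Real.exp_add,
        ← Real.exp_add]
      ring_nf
    rw [intervalIntegral.integral_congr key, intervalIntegral.integral_const_mul,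
      intervalIntegral.integral_sub (Continuous.intervalIntegrable (by fun_prop) _ _)
        (Continuous.intervalIntegrable (by fun_prop) _ _),
      intervalIntegral.integral_finset_sum
        (fun j _ => Continuous.intervalIntegrable (by fun_prop) _ _)]
    simp_rw [intervalIntegral.integral_const_mul]
    rw [integral_exp_neg _ _ h0]
    have e1 : ∀ j : Fin n, (Real.exp (-(lam j.succ * t)) * lagG (fun i => lam i.succ) j) *
          ∫ s in (0:ℝ)..t, Real.exp (-((lam 0 - lam j.succ) * s)) =
        (lam 0)⁻¹ * (Real.exp (-(lam j.succ * t)) * lagG lam j.succ) -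
        (lam 0)⁻¹ * Real.exp (-(lam 0 * t)) * lagG lam j.succ := by
      intro j
      rw [integral_exp_neg _ _ (hne j), lagG_succ]
      have : Real.exp (-(lam 0 * t)) = Real.exp (-(lam j.succ * t)) *
          Real.exp (-((lam 0 - lam j.succ) * t)) := by
        rw [← Real.exp_add]; ring_nf
      rw [this]
      have := hne j
      field_simp
    simp_rw [e1]
    rw [Finset.sum_sub_distrib, ← Finset.mul_sum, ← Finset.mul_sum]
    have hS := sum_lagG lam hd
    rw [Fin.sum_univ_succ] at hS
    rw [Fin.prod_univ_succ, Fin.sum_univ_succ (fun j => Real.exp (-(lam j * t)) * lagG lam j),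
      eq_sub_of_add_eq hS, mul_inv]
    field_simp
    ring

/-- Kent–Davis normalization constant of the truncated multivariate exponential on the
unit simplex, for pairwise distinct positive rates:
`∫_Δ exp(−Σ_j λ_j x_j) dx
  = (∏_j λ_j)⁻¹ Σ_j (1 − e^{−λ_j}) ∏_{i≠j} λ_i/(λ_i − λ_j)`. -/
theorem stmt10 (k : ℕ) (hk : 2 ≤ k) (lam : Fin (k - 1) → ℝ)
    (hpos : ∀ j, 0 < lam j) (hdist : Function.Injective lam) :
    ∫ x in {x : Fin (k - 1) → ℝ | (∀ j, 0 ≤ x j) ∧ ∑ j, x j ≤ 1},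
        Real.exp (-∑ j, lam j * x j) =
      (∏ j, lam j)⁻¹ *
        ∑ j, (1 - Real.exp (-(lam j))) *
          ∏ i ∈ Finset.univ.erase j, lam i / (lam i - lam j) := by
  obtain ⟨n, rfl⟩ : ∃ n, k = n + 2 := ⟨k - 2, by omega⟩
  have h := simplex_formula (n + 1) lam hpos hdist 1 zero_le_one
  refine h.trans ?_
  congr 1
  have hS : ∑ j, lagG lam j = 1 := sum_lagG (n := n) lam hdist
  refine (congrArg (fun z => z - ∑ j, Real.exp (-(lam j * 1)) * lagG lam j) hS.symm).trans ?_
  refine (Finset.sum_sub_distrib _ _).symm.trans ?_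
  refine Finset.sum_congr rfl fun j _ => ?_
  rw [mul_one, sub_mul, one_mul]
  rfl
end

section
/- Let M ≥ 1 and let q₁, …, q_M be positive real numbers, and let N be a real number with 0 < N < M. Then there exists a unique α > 0 such that Σ_{j=1}^M min(α·q_j, 1) = N. -/
lemma water_strict (M : ℕ) (q : Fin M → ℝ) (hq : ∀ j, 0 < q j)
    (N : ℝ) (hNM : N < M) (a b : ℝ) (hab : a < b)
    (ha : ∑ j, min (a * q j) 1 = N) : N < ∑ j, min (b * q j) 1 := by
  have hex : ∃ j, a * q j < 1 := by
    by_contra! h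
    have : ∑ j, min (a * q j) 1 = ∑ j : Fin M, (1 : ℝ) :=
      Finset.sum_congr rfl fun j _ => min_eq_right (h j)
    simp at this
    linarith
  obtain ⟨j, hj⟩ := hex
  rw [← ha]
  refine Finset.sum_lt_sum (fun i _ => ?_) ⟨j, Finset.mem_univ j, ?_⟩
  · exact min_le_min_right _ (mul_le_mul_of_nonneg_right hab.le (hq i).le)
  · rw [min_eq_left hj.le]
    exact lt_min (mul_lt_mul_of_pos_right hab (hq j)) hj

/-- Existence and uniqueness of the water-filling level: for positive weights
`q₁, …, q_M` and `0 < N < M`, there is a unique `α > 0` with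
`Σ_j min(α qⱼ, 1) = N`. -/
theorem stmt16 (M : ℕ) (hM : 1 ≤ M) (q : Fin M → ℝ) (hq : ∀ j, 0 < q j)
    (N : ℝ) (hN0 : 0 < N) (hNM : N < M) :
    ∃! α : ℝ, 0 < α ∧ ∑ j, min (α * q j) 1 = N := by
  have hB0 : 0 ≤ ∑ j, (q j)⁻¹ := Finset.sum_nonneg fun j _ => (inv_pos.2 (hq j)).le
  have hcont : Continuous fun a : ℝ => ∑ j, min (a * q j) 1 := by fun_prop
  have hB : ∑ j, min ((∑ i, (q i)⁻¹) * q j) 1 = (M : ℝ) := by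
    have : ∑ j, min ((∑ i, (q i)⁻¹) * q j) 1 = ∑ j : Fin M, (1 : ℝ) := by
      refine Finset.sum_congr rfl fun j _ => min_eq_right ?_
      have h1 : (q j)⁻¹ ≤ ∑ i, (q i)⁻¹ :=
        Finset.single_le_sum (f := fun i => (q i)⁻¹)
          (fun i _ => (inv_pos.2 (hq i)).le) (Finset.mem_univ j)
      calc (1 : ℝ) = (q j)⁻¹ * q j := (inv_mul_cancel₀ (hq j).ne').symm
        _ ≤ _ := mul_le_mul_of_nonneg_right h1 (hq j).le
    simpa using this
  obtain ⟨a, ⟨ha0, -⟩, ha⟩ := intermediate_value_Icc hB0 hcont.continuousOn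
    (show N ∈ Set.Icc _ _ from ⟨by simpa using hN0.le, by simpa only [hB] using hNM.le⟩)
  simp only at ha
  have hapos : 0 < a := by
    rcases ha0.lt_or_eq with h | h
    · exact h
    · subst h
      simp at ha
      linarith
  refine ⟨a, ⟨hapos, ha⟩, ?_⟩
  rintro b ⟨-, hb⟩
  rcases lt_trichotomy b a with h | h | h
  · have := water_strict M q hq N hNM b a h hb
    linarith
  · exact h
  · have := water_strict M q hq N hNM a b h ha
    linarith
end

section
/- Let M ≥ 1, let q₁, …, q_M be positive real numbers, let N be a real number with 0 < N < M, and let α > 0 be the unique solution of Σ_{j=1}^M min(α·q_j, 1) = N. Set p*_j = min(α·q_j, 1). Then p* minimizes Σ_{j=1}^M q_j²/p_j over all p = (p₁, …, p_M) with 0 < p_j ≤ 1 for all j and Σ_{j=1}^M p_j ≤ N; that is, for every such p, Σ_{j=1}^M q_j²/p_j ≥ Σ_{j=1}^M q_j²/p*_j. -/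
/-- Optimality of the water-filling solution: with `α > 0` the root of
`Σ_j min(α qⱼ, 1) = N`, the probabilities `p*ⱼ = min(α qⱼ, 1)` minimize
`Σ_j qⱼ²/pⱼ` over all `p` with `0 < pⱼ ≤ 1` and `Σ_j pⱼ ≤ N`. -/
theorem stmt17 (M : ℕ) (hM : 1 ≤ M) (q : Fin M → ℝ) (hq : ∀ j, 0 < q j)
    (N : ℝ) (hN0 : 0 < N) (hNM : N < M)
    (α : ℝ) (hα : 0 < α) (hroot : ∑ j, min (α * q j) 1 = N) :
    ∀ p : Fin M → ℝ, (∀ j, 0 < p j ∧ p j ≤ 1) → ∑ j, p j ≤ N →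
      ∑ j, (q j) ^ 2 / min (α * q j) 1 ≤ ∑ j, (q j) ^ 2 / p j := by
  intro p hp hs
  have key : ∀ j, (q j) ^ 2 / min (α * q j) 1 + min (α * q j) 1 / α ^ 2
      ≤ (q j) ^ 2 / p j + p j / α ^ 2 := by
    intro j
    obtain ⟨h0, h1⟩ := hp j
    have hqj := hq j
    rcases le_total (α * q j) 1 with h | h
    · rw [min_eq_left h]
      have e : (q j) ^ 2 / p j + p j / α ^ 2
          - ((q j) ^ 2 / (α * q j) + α * q j / α ^ 2)
          = (α * q j - p j) ^ 2 / (α ^ 2 * p j) := by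
        field_simp
        ring
      have : 0 ≤ (α * q j - p j) ^ 2 / (α ^ 2 * p j) := by positivity
      linarith
    · rw [min_eq_right h]
      have e : (q j) ^ 2 / p j + p j / α ^ 2 - ((q j) ^ 2 / 1 + 1 / α ^ 2)
          = (1 - p j) * ((α * q j) ^ 2 - p j) / (α ^ 2 * p j) := by
        field_simp
        ring
      have h2 : 0 ≤ (α * q j) ^ 2 - p j := by nlinarith
      have h3 : 0 ≤ 1 - p j := by linarith
      have : 0 ≤ (1 - p j) * ((α * q j) ^ 2 - p j) / (α ^ 2 * p j) := by positivity
      linarith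
  have hsum := Finset.sum_le_sum (fun j (_ : j ∈ Finset.univ) => key j)
  rw [Finset.sum_add_distrib, Finset.sum_add_distrib, ← Finset.sum_div _ _ (α ^ 2),
    ← Finset.sum_div _ _ (α ^ 2), hroot] at hsum
  have : (∑ j, p j) / α ^ 2 ≤ N / α ^ 2 := by gcongr
  linarith
end
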